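/- arXiv:1901.00142 — 3 statements merged into one kernel-verified Lean document; each statement's English description precedes it below -/
import Mathlib

section
/- For every fixed real a > 0, the polylogarithm of negative integer order satisfies Li_{-n}(e^{-a}) ~ n! · a^{-n-1} as n → ∞; that is, the limit as n → ∞ of a^{n+1} · Li_{-n}(e^{-a}) / n! equals 1. -/
open Filter

/-- The polylogarithm of negative integer order `-n` evaluated at `e^{-a}`:
`Li_{-n}(e^{-a}) = Σ_{m=1}^∞ m^n e^{-a m}`. -/
noncomputable def negOrderPolylog (n : ℕ) (a : ℝ) : ℝ :=
  ∑' m : ℕ, ((m : ℝ) + 1) ^ n * Real.exp (-a * ((m : ℝ) + 1))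

open scoped Nat

/-- The Lipschitz formula along the positive imaginary axis, normalised so that the term at
`k = 0` of the sum over `ℤ` is `1`. -/
lemma ofReal_pow_mul_negOrderPolylog_div_factorial {a : ℝ} {z : UpperHalfPlane}
    (hz : 2 * Real.pi * Complex.I * (z : ℂ) = -a) {n : ℕ} (hn : 1 ≤ n) :
    ((a ^ (n + 1) * negOrderPolylog n a / (n ! : ℝ) : ℝ) : ℂ) =
      ∑' k : ℤ, ((z : ℂ) / (z + k)) ^ (n + 1) := by
  have hsum : (negOrderPolylog n a : ℂ) =
      ∑' m : ℕ, (m : ℂ) ^ n * Complex.exp (2 * Real.pi * Complex.I * z) ^ m := by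
    have hs := summable_pow_mul_cexp n 1 z
    simp only [PNat.one_coe, Nat.cast_one, mul_one] at hs
    rw [hs.tsum_eq_zero_add, negOrderPolylog, Complex.ofReal_tsum]
    simp only [Nat.cast_zero, zero_pow (show n ≠ 0 by lia), zero_mul, zero_add]
    refine tsum_congr fun m ↦ ?_
    rw [hz, ← Complex.exp_nat_mul]
    push_cast
    ring_nf
  have key := EisensteinSeries.qExpansion_identity hn z
  rw [← hsum] at key
  simp_rw [div_pow, div_eq_mul_inv _ (((z : ℂ) + _) ^ _), tsum_mul_left]
  simp_rw [one_div] at key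
  rw [key]
  have ha' : (a : ℂ) = z * (-2 * Real.pi * Complex.I) := by linear_combination hz
  push_cast
  rw [ha', mul_pow]
  ring

lemma norm_div_add_intCast_lt_one {z : ℂ} (hre : z.re = 0) {k : ℤ} (hk : k ≠ 0) :
    ‖z / (z + k)‖ < 1 := by
  have hk' : (0 : ℝ) < (k : ℝ) ^ 2 := by positivity
  have hlt : ‖z‖ < ‖z + k‖ := by
    refine lt_of_pow_lt_pow_left₀ 2 (norm_nonneg _) ?_
    simp only [Complex.sq_norm, Complex.normSq_apply, Complex.add_re, Complex.add_im,
      Complex.intCast_re, Complex.intCast_im, hre]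
    nlinarith
  rw [norm_div, div_lt_one ((norm_nonneg _).trans_lt hlt)]
  exact hlt

lemma tendsto_tsum_div_add_intCast_pow (z : UpperHalfPlane) (hre : (z : ℂ).re = 0) :
    Tendsto (fun n : ℕ ↦ ∑' k : ℤ, ((z : ℂ) / (z + k)) ^ (n + 1)) atTop (nhds 1) := by
  have hz : (z : ℂ) ≠ 0 := z.ne_zero
  have hbound : Summable fun k : ℤ ↦ ‖(z : ℂ) / (z + k)‖ ^ 2 := by
    have h := ((EisensteinSeries.linear_right_summable z 1 (k := 2) le_rfl).mul_left
      ((z : ℂ) ^ 2)).norm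
    refine h.congr fun k ↦ ?_
    rw [← norm_pow, div_pow, div_eq_mul_inv]
    norm_num
  have hlim : (1 : ℂ) = ∑' k : ℤ, if k = 0 then 1 else 0 := by simp
  rw [hlim]
  refine tendsto_tsum_of_dominated_convergence hbound (fun k ↦ ?_) ?_
  · split_ifs with hk
    · simp [hk, hz]
    · exact (tendsto_pow_atTop_nhds_zero_of_norm_lt_one
        (norm_div_add_intCast_lt_one hre hk)).comp (tendsto_add_atTop_nat 1)
  · filter_upwards [eventually_ge_atTop 1] with n hn k
    rw [norm_pow]
    refine pow_le_pow_of_le_one (norm_nonneg _) ?_ (by lia)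
    rcases eq_or_ne k 0 with rfl | hk
    · simp [hz]
    · exact (norm_div_add_intCast_lt_one hre hk).le

theorem polylog_asymptotic (a : ℝ) (ha : 0 < a) :
    Tendsto (fun n : ℕ => a ^ (n + 1) * negOrderPolylog n a / (n.factorial : ℝ))
      atTop (nhds 1) := by
  have him : 0 < (Complex.I * (a / (2 * Real.pi) : ℝ)).im := by
    rw [Complex.I_mul_im, Complex.ofReal_re]
    positivity
  let z : UpperHalfPlane := ⟨Complex.I * (a / (2 * Real.pi) : ℝ), him⟩
  have hz : 2 * Real.pi * Complex.I * (z : ℂ) = -a := by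
    change 2 * Real.pi * Complex.I * (Complex.I * (a / (2 * Real.pi) : ℝ)) = -(a : ℂ)
    have hpi : (Real.pi : ℂ) ≠ 0 := Complex.ofReal_ne_zero.mpr Real.pi_ne_zero
    push_cast
    field_simp
    simp
  have hre : (z : ℂ).re = 0 := by
    change (Complex.I * (a / (2 * Real.pi) : ℝ)).re = 0
    rw [Complex.I_mul_re, Complex.ofReal_im, neg_zero]
  have h := tendsto_tsum_div_add_intCast_pow z hre
  rw [← Complex.ofReal_one] at h
  refine tendsto_ofReal_iff.mp (h.congr' ?_)
  filter_upwards [eventually_ge_atTop 1] with n hn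
  exact (ofReal_pow_mul_negOrderPolylog_div_factorial hz hn).symm
end

section
/- Let ν > 0 be a non-integer real and let a, b be positive reals with a > b. Then S_{K,ν}(a,b) = (π / (2 sin πν)) · ( Σ_{k=0}^∞ (b/2)^{2k−2ν} Li_{−2k+2ν}(e^{−a}) / (k! · Γ(1−ν+k)) − Σ_{k=0}^∞ (b/2)^{2k} Li_{−2k}(e^{−a}) / (k! · Γ(1+ν+k)) ), where both series on the right converge. -/
/-- The modified Bessel function of the first kind,
`I_μ(x) = (x/2)^μ Σ_{k=0}^∞ (x/2)^{2k} / (k! Γ(μ+k+1))`. -/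
noncomputable def besselI (μ x : ℝ) : ℝ :=
  (x / 2) ^ μ * ∑' k : ℕ, (x / 2) ^ (2 * k) / ((k.factorial : ℝ) * Real.Gamma (μ + k + 1))

/-- The modified Bessel function of the second kind (for non-integer order),
`K_ν(x) = π (I_{-ν}(x) - I_ν(x)) / (2 sin πν)`. -/
noncomputable def besselK (ν x : ℝ) : ℝ :=
  Real.pi * (besselI (-ν) x - besselI ν x) / (2 * Real.sin (Real.pi * ν))

/-- `S_{K,ν}(a,b) = Σ_{n=1}^∞ e^{-a n} (b n/2)^{-ν} K_ν(b n)`. -/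
noncomputable def SK (ν a b : ℝ) : ℝ :=
  ∑' n : ℕ, Real.exp (-a * ((n : ℝ) + 1)) * (b * ((n : ℝ) + 1) / 2) ^ (-ν) *
    besselK ν (b * ((n : ℝ) + 1))

/-- `Li_{-t}(e^{-a}) = Σ_{n=1}^∞ n^{t} e^{-a n}`, the polylogarithm of order `-t`. -/
noncomputable def polylogExp (t a : ℝ) : ℝ :=
  ∑' n : ℕ, ((n : ℝ) + 1) ^ t * Real.exp (-a * ((n : ℝ) + 1))

/-- For non-integer `μ`, the ratio `k! / Γ(μ+1+k)` grows subexponentially. -/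
lemma exists_inv_abs_Gamma_add_nat_le {μ : ℝ} (hμ : ∀ m : ℤ, μ ≠ (m : ℝ)) {r : ℝ} (hr : 1 < r) :
    ∃ C : ℝ, ∀ k : ℕ, |(Real.Gamma (μ + 1 + k))⁻¹| ≤ C * (r ^ k / (k.factorial : ℝ)) := by
  have hr0 : 0 < r := by linarith
  have hne : ∀ k : ℕ, μ + 1 + k ≠ 0 := fun k h => hμ (-(k + 1)) (by push_cast; linarith)
  have hG : ∀ k : ℕ, Real.Gamma (μ + 1 + k) ≠ 0 := fun k =>
    Real.Gamma_ne_zero fun m h => hμ (-(k + 1) - m) (by push_cast; linarith)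
  have hG' : ∀ k : ℕ,
      Real.Gamma (μ + 1 + (k + 1 : ℕ)) = (μ + 1 + k) * Real.Gamma (μ + 1 + k) := fun k => by
    rw [← Real.Gamma_add_one (hne k)]
    push_cast
    ring_nf
  set u : ℕ → ℝ := fun k => (k.factorial : ℝ) / r ^ k * (Real.Gamma (μ + 1 + k))⁻¹ with hu
  have hu0 : ∀ k, u k ≠ 0 := fun k =>
    mul_ne_zero (div_ne_zero (by positivity) (by positivity)) (inv_ne_zero (hG k))
  have hratio : ∀ k : ℕ, u (k + 1) / u k = r⁻¹ * (((k : ℝ) + 1) / (μ + 1 + k)) := fun k => by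
    have h1 := hG k
    have h2 := hne k
    have h3 : (k.factorial : ℝ) ≠ 0 := by positivity
    simp only [hu, hG', Nat.factorial_succ, pow_succ]
    push_cast
    field_simp
  have hlim1 : Filter.Tendsto (fun k : ℕ => ((k : ℝ) + 1) / (μ + 1 + k)) Filter.atTop
      (nhds 1) := by
    have h : Filter.Tendsto (fun k : ℕ => 1 - μ / (μ + 1 + (k : ℝ))) Filter.atTop
        (nhds (1 - 0)) :=
      tendsto_const_nhds.sub (Filter.Tendsto.div_atTop tendsto_const_nhds
        (Filter.tendsto_atTop_add_const_left _ _ tendsto_natCast_atTop_atTop))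
    rw [sub_zero] at h
    refine h.congr fun k => ?_
    have h2 := hne k
    field_simp
    ring
  have hlim : Filter.Tendsto (fun k => ‖u (k + 1)‖ / ‖u k‖) Filter.atTop (nhds r⁻¹) := by
    have h := (hlim1.const_mul r⁻¹).norm
    rw [mul_one, Real.norm_of_nonneg (by positivity : (0 : ℝ) ≤ r⁻¹)] at h
    refine h.congr fun k => ?_
    rw [← norm_div, hratio]
  have hsum : Summable u := summable_of_ratio_test_tendsto_lt_one
    (inv_lt_one_of_one_lt₀ hr) (Filter.Eventually.of_forall hu0) hlim
  refine ⟨∑' k, |u k|, fun k => ?_⟩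
  have hk : |u k| ≤ ∑' k, |u k| := hsum.abs.le_tsum k fun j _ => abs_nonneg _
  have hpos : 0 < r ^ k / (k.factorial : ℝ) := by positivity
  have hval : |(Real.Gamma (μ + 1 + k))⁻¹| = |u k| * (r ^ k / (k.factorial : ℝ)) := by
    rw [← abs_of_pos hpos, ← abs_mul]
    congr 1
    have h3 : (k.factorial : ℝ) ≠ 0 := by positivity
    simp only [hu]
    field_simp
  rw [hval]
  exact mul_le_mul_of_nonneg_right hk hpos.le

lemma factorial_two_mul_le_four_pow_mul (k : ℕ) :
    ((2 * k).factorial : ℝ) ≤ 4 ^ k * (k.factorial : ℝ) ^ 2 := by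
  have h := Nat.choose_mul_factorial_mul_factorial (show k ≤ 2 * k by lia)
  rw [show 2 * k - k = k by lia] at h
  have h4 : (2 * k).choose k ≤ 4 ^ k := by
    have := Nat.choose_le_two_pow (2 * k) k
    rwa [pow_mul] at this
  have : (2 * k).factorial ≤ 4 ^ k * k.factorial ^ 2 := by
    rw [← h, mul_assoc, ← sq]
    exact Nat.mul_le_mul_right _ h4
  exact_mod_cast this

/-- The terms `(bn/2)^{2k+p} e^{-an} / (k! Γ(μ+1+k))`, indexed by `(n - 1, k)`. -/
noncomputable def besselTerm (μ p a b : ℝ) (x : ℕ × ℕ) : ℝ :=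
  (b / 2) ^ (2 * (x.2 : ℝ) + p) *
    (((x.1 : ℝ) + 1) ^ (2 * (x.2 : ℝ) + p) * Real.exp (-a * ((x.1 : ℝ) + 1))) /
      ((x.2.factorial : ℝ) * Real.Gamma (μ + 1 + x.2))

lemma summable_exp_mul_cosh_series {a c : ℝ} (hc : 0 < c) (hca : c < a) :
    Summable fun x : ℕ × ℕ => Real.exp (-a * ((x.1 : ℝ) + 1)) *
      ((c * ((x.1 : ℝ) + 1)) ^ (2 * x.2) / ((2 * x.2).factorial : ℝ)) := by
  have hcosh : ∀ n : ℕ, HasSum (fun k : ℕ => Real.exp (-a * ((n : ℝ) + 1)) *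
      ((c * ((n : ℝ) + 1)) ^ (2 * k) / ((2 * k).factorial : ℝ)))
      (Real.exp (-a * ((n : ℝ) + 1)) * Real.cosh (c * ((n : ℝ) + 1))) := fun n =>
    (Real.hasSum_cosh _).mul_left _
  refine (summable_prod_of_nonneg fun x => by positivity).2 ⟨fun n => (hcosh n).summable, ?_⟩
  simp only [fun n => (hcosh n).tsum_eq]
  have hgeom : Summable fun n : ℕ => Real.exp (-(a - c)) * Real.exp (-(a - c)) ^ n :=
    (summable_geometric_of_lt_one (Real.exp_nonneg _)
      (Real.exp_lt_one_iff.2 (by linarith))).mul_left _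
  refine hgeom.of_nonneg_of_le
    (fun n => mul_nonneg (Real.exp_nonneg _) (Real.cosh_pos _).le) fun n => ?_
  have hle : Real.cosh (c * ((n : ℝ) + 1)) ≤ Real.exp (c * ((n : ℝ) + 1)) := by
    have hy : 0 ≤ c * ((n : ℝ) + 1) := by positivity
    have := Real.sinh_nonneg_iff.2 hy
    rw [← Real.cosh_add_sinh]
    linarith
  calc _ ≤ Real.exp (-a * ((n : ℝ) + 1)) * Real.exp (c * ((n : ℝ) + 1)) := by gcongr
    _ = _ := by
      rw [← Real.exp_nat_mul, ← Real.exp_add, ← Real.exp_add]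
      ring_nf

lemma summable_besselTerm {μ p a b : ℝ} (hμ : ∀ m : ℤ, μ ≠ (m : ℝ)) (hp : p ≤ 0)
    (hb : 0 < b) (hab : b < a) : Summable (besselTerm μ p a b) := by
  obtain ⟨c, hbc, hca⟩ := exists_between hab
  have hc : 0 < c := hb.trans hbc
  obtain ⟨C, hC⟩ := exists_inv_abs_Gamma_add_nat_le hμ
    (one_lt_pow₀ ((one_lt_div hb).2 hbc) two_ne_zero)
  have hC0 : 0 ≤ C := by
    have := (abs_nonneg _).trans (hC 0)
    simpa using this
  refine ((summable_exp_mul_cosh_series hc hca).mul_left ((b / 2) ^ p * C)).of_norm_bounded ?_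
  rintro ⟨n, k⟩
  have hn : (0 : ℝ) < (n : ℝ) + 1 := by positivity
  have hn1 : ((n : ℝ) + 1) ^ p ≤ 1 :=
    Real.rpow_le_one_of_one_le_of_nonpos (by linarith [n.cast_nonneg (α := ℝ)]) hp
  have hsplit : ∀ y : ℝ, 0 < y → y ^ (2 * (k : ℝ) + p) = y ^ (2 * k) * y ^ p := fun y hy => by
    rw [Real.rpow_add hy, ← Real.rpow_natCast]
    push_cast
    rfl
  have hnorm : ‖besselTerm μ p a b (n, k)‖ =
      (b / 2) ^ p * Real.exp (-a * ((n : ℝ) + 1)) * (b / 2 * ((n : ℝ) + 1)) ^ (2 * k) *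
        ((n : ℝ) + 1) ^ p * ((k.factorial : ℝ)⁻¹ * |(Real.Gamma (μ + 1 + k))⁻¹|) := by
    simp only [besselTerm]
    rw [hsplit _ (half_pos hb), hsplit _ hn, div_eq_mul_inv, mul_inv, norm_mul, norm_mul _ (_⁻¹),
      Real.norm_of_nonneg (by positivity), Real.norm_of_nonneg (by positivity),
      Real.norm_eq_abs, mul_pow]
    ring
  have hfact : ((k.factorial : ℝ) ^ 2)⁻¹ ≤ 4 ^ k * ((2 * k).factorial : ℝ)⁻¹ := by
    rw [← div_eq_mul_inv, le_div_iff₀ (by positivity), inv_mul_le_iff₀ (by positivity),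
      mul_comm (_ ^ 2)]
    exact factorial_two_mul_le_four_pow_mul k
  rw [hnorm]
  calc _ ≤ (b / 2) ^ p * Real.exp (-a * ((n : ℝ) + 1)) * (b / 2 * ((n : ℝ) + 1)) ^ (2 * k) *
        1 * ((k.factorial : ℝ)⁻¹ * (C * (((c / b) ^ 2) ^ k / (k.factorial : ℝ)))) := by
        gcongr
        exact hC k
    _ = (b / 2) ^ p * Real.exp (-a * ((n : ℝ) + 1)) * (b / 2 * ((n : ℝ) + 1)) ^ (2 * k) *
        C * ((c / b) ^ 2) ^ k * ((k.factorial : ℝ) ^ 2)⁻¹ := by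
        field_simp
    _ ≤ (b / 2) ^ p * Real.exp (-a * ((n : ℝ) + 1)) * (b / 2 * ((n : ℝ) + 1)) ^ (2 * k) *
        C * ((c / b) ^ 2) ^ k * (4 ^ k * ((2 * k).factorial : ℝ)⁻¹) := by gcongr
    _ = _ := by
        have h : (c * ((n : ℝ) + 1)) ^ (2 * k) =
            (b / 2 * ((n : ℝ) + 1)) ^ (2 * k) * ((c / b) ^ 2) ^ k * 4 ^ k := by
          rw [pow_mul, pow_mul, ← mul_pow, ← mul_pow]
          congr 1
          field_simp
          ring
        rw [h]
        ring

lemma tsum_besselTerm_left (μ p a b : ℝ) (k : ℕ) :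
    ∑' n : ℕ, besselTerm μ p a b (n, k) =
      (b / 2) ^ (2 * (k : ℝ) + p) * polylogExp (2 * (k : ℝ) + p) a /
        ((k.factorial : ℝ) * Real.Gamma (μ + 1 + k)) := by
  simp only [besselTerm, polylogExp]
  rw [tsum_div_const, tsum_mul_left]

lemma tsum_besselTerm_right (μ ν a : ℝ) {b : ℝ} (hb : 0 < b) (n : ℕ) :
    ∑' k : ℕ, besselTerm μ (μ - ν) a b (n, k) =
      Real.exp (-a * ((n : ℝ) + 1)) * (b * ((n : ℝ) + 1) / 2) ^ (-ν) *
        besselI μ (b * ((n : ℝ) + 1)) := by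
  have hx : 0 < b * ((n : ℝ) + 1) / 2 := by positivity
  rw [besselI, ← mul_assoc, ← tsum_mul_left]
  refine tsum_congr fun k => ?_
  have hpow : (b / 2) ^ (2 * (k : ℝ) + (μ - ν)) * ((n : ℝ) + 1) ^ (2 * (k : ℝ) + (μ - ν)) =
      (b * ((n : ℝ) + 1) / 2) ^ (-ν) * (b * ((n : ℝ) + 1) / 2) ^ μ *
        (b * ((n : ℝ) + 1) / 2) ^ (2 * k) := by
    rw [← Real.mul_rpow (by positivity) (by positivity), ← Real.rpow_natCast,
      ← Real.rpow_add hx, ← Real.rpow_add hx]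
    push_cast
    ring_nf
  simp only [besselTerm]
  rw [← mul_assoc, hpow, add_right_comm μ 1 (k : ℝ)]
  ring

theorem SK_polylog_series (ν a b : ℝ) (hν : 0 < ν) (hint : ∀ m : ℤ, ν ≠ (m : ℝ))
    (hb : 0 < b) (hab : b < a) :
    Summable (fun k : ℕ =>
      (b / 2) ^ (2 * (k : ℝ) - 2 * ν) * polylogExp (2 * (k : ℝ) - 2 * ν) a /
        ((k.factorial : ℝ) * Real.Gamma (1 - ν + k))) ∧
    Summable (fun k : ℕ =>
      (b / 2) ^ (2 * k) * polylogExp (2 * (k : ℝ)) a /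
        ((k.factorial : ℝ) * Real.Gamma (1 + ν + k))) ∧
    SK ν a b = (Real.pi / (2 * Real.sin (Real.pi * ν))) *
      ((∑' k : ℕ, (b / 2) ^ (2 * (k : ℝ) - 2 * ν) * polylogExp (2 * (k : ℝ) - 2 * ν) a /
          ((k.factorial : ℝ) * Real.Gamma (1 - ν + k))) -
        ∑' k : ℕ, (b / 2) ^ (2 * k) * polylogExp (2 * (k : ℝ)) a /
          ((k.factorial : ℝ) * Real.Gamma (1 + ν + k))) := by
  have hneg : ∀ m : ℤ, -ν ≠ (m : ℝ) := fun m h => hint (-m) (by push_cast; linarith)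
  have hs₁ := summable_besselTerm (p := -ν - ν) hneg (by linarith) hb hab
  have hs₂ := summable_besselTerm (p := ν - ν) hint (by linarith) hb hab
  have hterm₁ : ∀ k : ℕ, (b / 2) ^ (2 * (k : ℝ) - 2 * ν) * polylogExp (2 * (k : ℝ) - 2 * ν) a /
      ((k.factorial : ℝ) * Real.Gamma (1 - ν + k)) =
      ∑' n : ℕ, besselTerm (-ν) (-ν - ν) a b (n, k) := fun k => by
    rw [tsum_besselTerm_left, show 2 * (k : ℝ) + (-ν - ν) = 2 * (k : ℝ) - 2 * ν by ring,
      show -ν + 1 + (k : ℝ) = 1 - ν + k by ring]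
  have hterm₂ : ∀ k : ℕ, (b / 2) ^ (2 * k) * polylogExp (2 * (k : ℝ)) a /
      ((k.factorial : ℝ) * Real.Gamma (1 + ν + k)) =
      ∑' n : ℕ, besselTerm ν (ν - ν) a b (n, k) := fun k => by
    rw [tsum_besselTerm_left, sub_self, add_zero, add_comm ν 1, ← Real.rpow_natCast]
    push_cast
    rfl
  simp only [hterm₁, hterm₂]
  refine ⟨hs₁.prod_symm.prod, hs₂.prod_symm.prod, ?_⟩
  have hswap : ∀ {f : ℕ × ℕ → ℝ}, Summable f →
      ∑' (k : ℕ) (n : ℕ), f (n, k) = ∑' (n : ℕ) (k : ℕ), f (n, k) :=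
    fun {f} hf => Summable.tsum_comm (f := fun n k => f (n, k)) hf
  rw [hswap hs₁, hswap hs₂, ← hs₁.prod.tsum_sub hs₂.prod, ← tsum_mul_left, SK]
  refine tsum_congr fun n => ?_
  rw [tsum_besselTerm_right _ _ _ hb, tsum_besselTerm_right _ _ _ hb, besselK]
  ring
end

section
/- Let a, b be positive reals with a + b < 2π. Then S_{K,1/2}(a,b) := Σ_{n=1}^∞ e^{−a n} (b n/2)^{−1/2} K_{1/2}(b n) = (√π / b) · ( Σ_{k=1}^∞ ((−1)^k / k!) ζ(1−k) (a+b)^k − log(a+b) ), where the series on the right converges and ζ is the Riemann zeta function. -/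
/-- The Riemann zeta function restricted to real arguments. -/
noncomputable def realZeta (s : ℝ) : ℝ := (riemannZeta (s : ℂ)).re

/-- The modified Bessel function of the second kind of order `1/2`,
`K_{1/2}(x) = √(π/(2x)) e^{-x}`. -/
noncomputable def besselKhalf (x : ℝ) : ℝ :=
  Real.sqrt (Real.pi / (2 * x)) * Real.exp (-x)

open Set Filter Topology in
theorem exists_abs_bernoulli_div_factorial_mul_le :
    ∃ C : ℝ, ∀ n : ℕ, |(bernoulli n : ℝ) / n.factorial| * (2 * Real.pi) ^ n ≤ C := by
  set S : ℝ := ∑' n : ℤ, |1 / (n : ℝ) ^ 2| with hS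
  have hsum : Summable fun n : ℤ => |1 / (n : ℝ) ^ 2| :=
    (Real.summable_one_div_int_pow.mpr one_lt_two).abs
  have hlarge : ∀ n : ℕ, 2 ≤ n →
      |(bernoulli n : ℝ) / n.factorial| * (2 * Real.pi) ^ n ≤ S := by
    intro n hn
    have h := hasSum_one_div_pow_mul_fourier_mul_bernoulliFun hn (x := 0) (by simp)
    have hb : ∀ m : ℤ, ‖1 / (m : ℂ) ^ n * fourier m ((0 : ℝ) : UnitAddCircle)‖ ≤
        |1 / (m : ℝ) ^ 2| := by
      intro m
      rcases eq_or_ne m 0 with rfl | hm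
      · simp [show n ≠ 0 by lia]
      · have h1 : (1 : ℝ) ≤ |(m : ℝ)| := by exact_mod_cast Int.one_le_abs hm
        have : |(m : ℝ)| ^ 2 ≤ |(m : ℝ)| ^ n := pow_le_pow_right₀ h1 hn
        simp only [fourier_coe_apply, norm_mul, norm_div, norm_pow, norm_one, Complex.norm_intCast,
          abs_div, abs_one, abs_pow]
        simp
        rw [← sq_abs]
        gcongr
    have hle := tsum_of_norm_bounded hsum.hasSum hb
    rw [h.tsum_eq, bernoulliFun_eval_zero] at hle
    refine le_of_eq_of_le ?_ hle
    simp [abs_div, abs_of_pos Real.pi_pos, mul_pow]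
    ring
  refine ⟨S + 1 + 2 * Real.pi, fun n => ?_⟩
  have hS0 : 0 ≤ S := tsum_nonneg fun _ => abs_nonneg _
  have hpi := Real.pi_pos
  match n with
  | 0 => simp; linarith
  | 1 => norm_num [abs_div]; linarith
  | n + 2 => linarith [hlarge (n + 2) (by lia)]

theorem abs_bernoulli_div_factorial_mul_pow_le {C r x : ℝ} {n : ℕ}
    (hC : |(bernoulli n : ℝ) / n.factorial| * (2 * Real.pi) ^ n ≤ C) (hx : |x| ≤ r) :
    ‖(bernoulli n : ℝ) / n.factorial * x ^ n‖ ≤ C * (r / (2 * Real.pi)) ^ n := by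
  have hpi : 0 < (2 * Real.pi) ^ n := by positivity
  have hr : 0 ≤ r := (abs_nonneg x).trans hx
  rw [norm_mul, norm_pow, Real.norm_eq_abs, Real.norm_eq_abs, div_pow, mul_div_assoc',
    le_div_iff₀ hpi]
  calc _ = |(bernoulli n : ℝ) / n.factorial| * (2 * Real.pi) ^ n * |x| ^ n := by ring
    _ ≤ C * r ^ n := by gcongr; exact (by positivity : (0 : ℝ) ≤ _).trans hC

theorem summable_norm_bernoulli_div_factorial_mul_pow {x : ℝ} (hx : |x| < 2 * Real.pi) :
    Summable fun n : ℕ => ‖(bernoulli n : ℝ) / n.factorial * x ^ n‖ := by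
  obtain ⟨C, hC⟩ := exists_abs_bernoulli_div_factorial_mul_le
  have hpi := Real.pi_pos
  refine Summable.of_nonneg_of_le (fun _ => norm_nonneg _)
    (fun n => abs_bernoulli_div_factorial_mul_pow_le (hC n) le_rfl)
    ((summable_geometric_of_lt_one (by positivity) ?_).mul_left C)
  rwa [div_lt_one (by positivity)]

theorem tsum_bernoulli_div_factorial_mul_pow_mul {x : ℝ} (hx : |x| < 2 * Real.pi) :
    (∑' n : ℕ, (bernoulli n : ℝ) / n.factorial * x ^ n) * (Real.exp x - 1) = x := by
  have hB := summable_norm_bernoulli_div_factorial_mul_pow hx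
  have hE : HasSum (fun n : ℕ => x ^ n / n.factorial) (Real.exp x) := by
    rw [Real.exp_eq_exp_ℝ]; exact NormedSpace.expSeries_div_hasSum_exp x
  have hps : bernoulliPowerSeries ℝ * PowerSeries.exp ℝ =
      bernoulliPowerSeries ℝ + PowerSeries.X := by
    linear_combination bernoulliPowerSeries_mul_exp_sub_one ℝ
  have hprod := tsum_mul_tsum_eq_tsum_sum_antidiagonal_of_summable_norm hB hE.summable.norm
  have hcoeff : ∀ n : ℕ, ∑ kl ∈ Finset.HasAntidiagonal.antidiagonal n,
      (bernoulli kl.1 : ℝ) / kl.1.factorial * x ^ kl.1 * (x ^ kl.2 / kl.2.factorial) =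
      (bernoulli n : ℝ) / n.factorial * x ^ n + if n = 1 then x else 0 := by
    intro n
    have h := congrArg (PowerSeries.coeff n) hps
    rw [PowerSeries.coeff_mul, map_add, PowerSeries.coeff_X] at h
    simp only [bernoulliPowerSeries, PowerSeries.coeff_mk, PowerSeries.coeff_exp] at h
    have h2 := congrArg (· * x ^ n) h
    simp only [Finset.sum_mul] at h2
    trans ((algebraMap ℚ ℝ) (bernoulli n / n.factorial) + if n = 1 then 1 else 0) * x ^ n
    · rw [← h2]
      refine Finset.sum_congr rfl fun kl hkl => ?_
      rw [← Finset.HasAntidiagonal.mem_antidiagonal.mp hkl, pow_add]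
      simp
      ring
    · split_ifs with h1
      · subst h1; simp; ring
      · simp
  simp only [hcoeff] at hprod
  rw [hE.tsum_eq, Summable.tsum_add hB.of_norm (summable_of_ne_finset_zero (s := {1})
    (fun b hb => if_neg (by simpa using hb))), tsum_ite_eq] at hprod
  linear_combination hprod

/-- The primitive, vanishing at `0`, of `1 / x - 1 / (exp x - 1)`, as a power series. -/
noncomputable def bernoulliPrimitive (x : ℝ) : ℝ :=
  ∑' n : ℕ, -((bernoulli (n + 1) : ℝ) / (n + 1).factorial / (n + 1)) * x ^ (n + 1)

theorem summable_bernoulliPrimitive {x : ℝ} (hx : |x| < 2 * Real.pi) :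
    Summable fun n : ℕ =>
      -((bernoulli (n + 1) : ℝ) / (n + 1).factorial / (n + 1)) * x ^ (n + 1) := by
  refine Summable.of_norm_bounded
    ((summable_nat_add_iff 1).mpr (summable_norm_bernoulli_div_factorial_mul_pow hx))
    fun n => ?_
  have h1 : (1 : ℝ) ≤ |(n : ℝ) + 1| := by
    rw [abs_of_pos (by positivity)]; linarith [n.cast_nonneg (α := ℝ)]
  rw [norm_mul, norm_mul, norm_neg, norm_div _ ((n : ℝ) + 1)]
  gcongr
  exact div_le_self (norm_nonneg _) h1

theorem hasDerivAt_bernoulliPrimitive {x : ℝ} (hx : |x| < 2 * Real.pi) :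
    HasDerivAt bernoulliPrimitive
      (∑' n : ℕ, -((bernoulli (n + 1) : ℝ) / (n + 1).factorial) * x ^ n) x := by
  obtain ⟨C, hC⟩ := exists_abs_bernoulli_div_factorial_mul_le
  obtain ⟨r, hxr, hr⟩ := exists_between hx
  have hr0 : 0 < r := (abs_nonneg x).trans_lt hxr
  have hpi := Real.pi_pos
  have hu : Summable fun n : ℕ => C * (r / (2 * Real.pi)) ^ (n + 1) / r :=
    (((summable_nat_add_iff 1).mpr (summable_geometric_of_lt_one (by positivity)
      ((div_lt_one (by positivity)).mpr hr))).mul_left C).div_const r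
  refine hasDerivAt_tsum_of_isPreconnected (t := Metric.ball 0 r) (y₀ := x)
    (g := fun n y => -((bernoulli (n + 1) : ℝ) / (n + 1).factorial / (n + 1)) * y ^ (n + 1))
    (g' := fun n y => -((bernoulli (n + 1) : ℝ) / (n + 1).factorial) * y ^ n)
    hu Metric.isOpen_ball (convex_ball _ _).isPreconnected (fun n y _ => ?_) (fun n y hy => ?_)
    (by simpa using hxr) (summable_bernoulliPrimitive hx) (by simpa using hxr)
  · refine ((hasDerivAt_pow (n + 1) y).const_mul
      (-((bernoulli (n + 1) : ℝ) / (n + 1).factorial / (n + 1)))).congr_deriv ?_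
    have : (n : ℝ) + 1 ≠ 0 := by positivity
    push_cast
    field_simp
  · have h := abs_bernoulli_div_factorial_mul_pow_le (x := r) (hC (n + 1)) (abs_of_pos hr0).le
    rw [norm_mul, norm_pow, Real.norm_of_nonneg hr0.le] at h
    have hy' : ‖y‖ ≤ r := by simpa using (Metric.mem_ball.mp hy).le
    rw [le_div_iff₀ hr0, norm_mul, norm_neg, norm_pow]
    refine le_trans ?_ h
    rw [mul_assoc, pow_succ]
    gcongr

open Set Filter Topology in
theorem bernoulliPrimitive_eq {x : ℝ} (hx0 : 0 < x) (hx : x < 2 * Real.pi) :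
    bernoulliPrimitive x = Real.log x - Real.log (1 - Real.exp (-x)) := by
  have hlt : ∀ y : ℝ, 0 < y → 0 < 1 - Real.exp (-y) := fun y hy => by
    simpa using hy
  have hderiv : ∀ y ∈ Ioo 0 (2 * Real.pi), HasDerivAt
      (fun y => bernoulliPrimitive y - Real.log y + Real.log (1 - Real.exp (-y))) 0 y := by
    intro y hy
    have habs : |y| < 2 * Real.pi := by rw [abs_of_pos hy.1]; exact hy.2
    have hE : 0 < Real.exp y - 1 := by simpa using hy.1
    have hsum := (summable_norm_bernoulli_div_factorial_mul_pow habs).of_norm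
    have h := tsum_bernoulli_div_factorial_mul_pow_mul habs
    rw [hsum.tsum_eq_zero_add] at h
    have hd : (∑' n : ℕ, -((bernoulli (n + 1) : ℝ) / (n + 1).factorial) * y ^ n) =
        1 / y - 1 / (Real.exp y - 1) := by
      have h' : (∑' n : ℕ, (bernoulli (n + 1) : ℝ) / (n + 1).factorial * y ^ (n + 1)) =
          -y * ∑' n : ℕ, -((bernoulli (n + 1) : ℝ) / (n + 1).factorial) * y ^ n := by
        rw [← tsum_mul_left]
        exact tsum_congr fun n => by ring
      rw [h', bernoulli_zero, Nat.factorial_zero, pow_zero, Rat.cast_one, Nat.cast_one, div_one,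
        mul_one] at h
      generalize (∑' n : ℕ, -((bernoulli (n + 1) : ℝ) / (n + 1).factorial) * y ^ n) = T at h
      have h0 := hy.1.ne'
      have h1 := hE.ne'
      rw [div_sub_div _ _ h0 h1, eq_div_iff (mul_ne_zero h0 h1)]
      linear_combination -h
    have h1 : HasDerivAt (fun y : ℝ => 1 - Real.exp (-y)) (Real.exp (-y)) y := by
      simpa using ((hasDerivAt_neg y).exp).const_sub 1
    refine (((hasDerivAt_bernoulliPrimitive habs).sub (Real.hasDerivAt_log hy.1.ne')).add
      (h1.log (hlt y hy.1).ne')).congr_deriv ?_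
    rw [hd, Real.exp_neg]
    have := hy.1.ne'
    have := Real.exp_pos y
    have h3 : 1 - (Real.exp y)⁻¹ = (Real.exp y - 1) / Real.exp y := by field_simp
    rw [h3]
    field_simp
    ring
  obtain ⟨c, hc⟩ := isOpen_Ioo.exists_is_const_of_deriv_eq_zero
    (isPreconnected_Ioo (a := (0 : ℝ)) (b := 2 * Real.pi))
    (fun y hy => (hderiv y hy).differentiableAt.differentiableWithinAt)
    (fun y hy => (hderiv y hy).deriv)
  have hlim : Tendsto (fun y => bernoulliPrimitive y - Real.log y + Real.log (1 - Real.exp (-y)))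
      (𝓝[>] 0) (𝓝 0) := by
    have hF : Tendsto bernoulliPrimitive (𝓝[>] 0) (𝓝 0) := by
      have h := (hasDerivAt_bernoulliPrimitive (x := 0) (by simpa using Real.pi_pos)).continuousAt
      have h0 : bernoulliPrimitive 0 = 0 := by simp [bernoulliPrimitive]
      rw [ContinuousAt, h0] at h
      exact h.mono_left nhdsWithin_le_nhds
    have hq : Tendsto (fun y : ℝ => y⁻¹ * (1 - Real.exp (-y))) (𝓝[>] 0) (𝓝 1) := by
      have h1 : HasDerivAt (fun y : ℝ => 1 - Real.exp (-y)) 1 0 := by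
        simpa using ((hasDerivAt_neg (0 : ℝ)).exp).const_sub 1
      simpa using h1.tendsto_slope_zero_right
    have hlog := hF.add (hq.log one_ne_zero)
    rw [Real.log_one, add_zero] at hlog
    refine hlog.congr' (eventually_mem_nhdsWithin.mono fun y hy => ?_)
    have hy : 0 < y := hy
    rw [Real.log_mul (inv_pos.mpr hy).ne' (hlt y hy).ne', Real.log_inv]
    ring
  have hc0 : c = 0 := by
    refine tendsto_nhds_unique (tendsto_const_nhds.congr' ?_) hlim
    filter_upwards [Ioo_mem_nhdsGT (show (0 : ℝ) < 2 * Real.pi by positivity)] with y hy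
    exact (hc y hy).symm
  have := hc x ⟨hx0, hx⟩
  simp only [hc0] at this
  linarith

theorem realZeta_one_sub_nat_add_one (k : ℕ) :
    realZeta (1 - ((k : ℝ) + 1)) = (-1) ^ k * bernoulli (k + 1) / (k + 1) := by
  have h : (((1 - ((k : ℝ) + 1) : ℝ)) : ℂ) = -(k : ℂ) := by push_cast; ring
  rw [realZeta, h, riemannZeta_neg_nat_eq_bernoulli]
  have h2 : ((-1 : ℂ) ^ k * (bernoulli (k + 1) : ℂ) / ((k : ℂ) + 1)) =
      (((-1) ^ k * bernoulli (k + 1) / (k + 1) : ℝ) : ℂ) := by push_cast; rfl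
  rw [h2, Complex.ofReal_re]

theorem rpow_mul_besselKhalf {x : ℝ} (hx : 0 < x) :
    (x / 2) ^ (-(1 / 2) : ℝ) * besselKhalf x = Real.sqrt Real.pi / x * Real.exp (-x) := by
  rw [besselKhalf, Real.rpow_neg (by positivity), ← Real.sqrt_eq_rpow, ← Real.sqrt_inv,
    ← mul_assoc, ← Real.sqrt_mul (by positivity)]
  congr 1
  rw [show (x / 2)⁻¹ * (Real.pi / (2 * x)) = Real.pi / x ^ 2 by field_simp,
    Real.sqrt_div' _ (by positivity), Real.sqrt_sq hx.le]

theorem SK_half (a b : ℝ) (ha : 0 < a) (hb : 0 < b) (hab : a + b < 2 * Real.pi) :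
    Summable (fun k : ℕ =>
      (-1 : ℝ) ^ (k + 1) / ((k + 1).factorial : ℝ) * realZeta (1 - ((k : ℝ) + 1)) *
        (a + b) ^ (k + 1)) ∧
    (∑' n : ℕ, Real.exp (-a * ((n : ℝ) + 1)) *
        (b * ((n : ℝ) + 1) / 2) ^ (-(1/2) : ℝ) * besselKhalf (b * ((n : ℝ) + 1))) =
      (Real.sqrt Real.pi / b) *
        ((∑' k : ℕ, (-1 : ℝ) ^ (k + 1) / ((k + 1).factorial : ℝ) *
            realZeta (1 - ((k : ℝ) + 1)) * (a + b) ^ (k + 1))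
          - Real.log (a + b)) := by
  have ht : 0 < a + b := add_pos ha hb
  have hterm : ∀ k : ℕ,
      (-1 : ℝ) ^ (k + 1) / ((k + 1).factorial : ℝ) * realZeta (1 - ((k : ℝ) + 1)) *
        (a + b) ^ (k + 1) =
      -((bernoulli (k + 1) : ℝ) / (k + 1).factorial / (k + 1)) * (a + b) ^ (k + 1) := by
    intro k
    have h : (-1 : ℝ) ^ k * (-1) ^ k = 1 := by rw [← mul_pow]; simp
    rw [realZeta_one_sub_nat_add_one]
    linear_combination (-((bernoulli (k + 1) : ℝ) / (k + 1).factorial / (k + 1)) *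
      (a + b) ^ (k + 1)) * h
  simp only [hterm]
  refine ⟨summable_bernoulliPrimitive (by rwa [abs_of_pos ht]), ?_⟩
  have hprim := bernoulliPrimitive_eq ht hab
  rw [bernoulliPrimitive] at hprim
  rw [hprim]
  have hlog := Real.hasSum_pow_div_log_of_abs_lt_one (x := Real.exp (-(a + b)))
    (by rw [abs_of_pos (Real.exp_pos _), Real.exp_lt_one_iff]; linarith)
  rw [sub_sub_cancel_left, ← hlog.tsum_eq, ← tsum_mul_left]
  refine tsum_congr fun n => ?_
  have hn : (0 : ℝ) < n + 1 := by positivity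
  rw [mul_assoc, rpow_mul_besselKhalf (by positivity), ← Real.exp_nat_mul]
  have he : Real.exp (((n + 1 : ℕ) : ℝ) * -(a + b)) =
      Real.exp (-a * ((n : ℝ) + 1)) * Real.exp (-(b * ((n : ℝ) + 1))) := by
    rw [← Real.exp_add]; congr 1; push_cast; ring
  rw [he]
  field_simp
end
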